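/- arXiv:2102.13182 — 3 statements merged into one kernel-verified Lean document; each statement's English description precedes it below -/
import Mathlib

section
/- Let f be a probability density function on ℝ^d whose marginal densities are f_1, …, f_d with associated marginal cdfs F_1, …, F_d, each F_i continuous. Then there exists a copula density c : [0,1]^d → ℝ≥0 such that f(z_1, …, z_d) = c(F_1(z_1), …, F_d(z_d)) · ∏_{i=1}^d f_i(z_i) for Lebesgue-almost every z ∈ ℝ^d, and c is unique up to modification on a Lebesgue-null subset of [0,1]^d. -/
open MeasureTheory Real Set Filter

noncomputable section
open scoped Classical

/-- The unit cube `[0,1]^d`. -/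
def Cube (d : ℕ) : Set (Fin d → ℝ) := Set.univ.pi fun _ => Set.Icc (0:ℝ) 1

/-- The uniform distribution on `[0,1]`. -/
def unif01 : Measure ℝ := volume.restrict (Set.Icc (0:ℝ) 1)

/-- A copula distribution on `[0,1]^d`: a probability measure supported on the cube,
absolutely continuous w.r.t. Lebesgue measure, with uniform one-dimensional marginals. -/
structure IsCopula {d : ℕ} (P : Measure (Fin d → ℝ)) : Prop where
  prob : IsProbabilityMeasure P
  ac : P ≪ volume
  mass : P (Cube d) = 1
  marg : ∀ i : Fin d, P.map (fun u => u i) = unif01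

/-- Lebesgue density of a measure. -/
def dens {α : Type*} [MeasureSpace α] (P : Measure α) : α → ℝ :=
  fun x => (P.rnDeriv volume x).toReal

/-- Differential entropy `-∫ p log p` (w.r.t. Lebesgue measure). -/
def diffEnt {α : Type*} [MeasureSpace α] (P : Measure α) : ℝ :=
  - ∫ x, dens P x * Real.log (dens P x)

/-- The differential entropy of `P` exists and is finite. -/
def FiniteEnt {α : Type*} [MeasureSpace α] (P : Measure α) : Prop :=
  Integrable (fun x => dens P x * Real.log (dens P x))

open ProbabilityTheory Topology in
/-- Probability integral transform. -/
theorem map_cdf_eq_unif01 (ν : Measure ℝ) [IsProbabilityMeasure ν]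
    (hc : Continuous (cdf ν)) : ν.map (cdf ν) = unif01 := by
  have : IsProbabilityMeasure (ν.map (cdf ν)) :=
    Measure.isProbabilityMeasure_map hc.measurable.aemeasurable
  have hvol (a : ℝ) (h0 : 0 ≤ a) (h1 : a ≤ 1) : unif01 (Iic a) = ENNReal.ofReal a := by
    have : Iic a ∩ Icc 0 1 = Icc 0 a := by ext x; simp; grind
    simp [unif01, Measure.restrict_apply measurableSet_Iic, this]
  refine Measure.ext_of_Iic _ _ fun a ↦ ?_
  rw [Measure.map_apply hc.measurable measurableSet_Iic]
  rcases lt_or_ge a 0 with ha | ha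
  · have h1 : cdf ν ⁻¹' Iic a = ∅ := by
      ext x; simpa using ha.trans_le (cdf_nonneg ν x)
    have h2 : Iic a ∩ Icc 0 1 = ∅ := by ext x; simp; grind
    simp [unif01, Measure.restrict_apply measurableSet_Iic, h1, h2]
  rcases le_or_gt 1 a with ha1 | ha1
  · have h1 : cdf ν ⁻¹' Iic a = univ := by
      ext x; simpa using (cdf_le_one ν x).trans ha1
    have h2 : Iic a ∩ Icc 0 1 = Icc 0 1 := by ext x; simp; grind
    simp [unif01, Measure.restrict_apply measurableSet_Iic, h1, h2]
  rw [hvol a ha ha1.le]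
  have key (b : ℝ) (h0 : 0 < b) (h1 : b < 1) : ∃ x, cdf ν x = b :=
    mem_range_of_exists_le_of_exists_ge hc
      (((tendsto_cdf_atBot ν).eventually_lt_const h0).exists.imp fun _ h ↦ h.le)
      (((tendsto_cdf_atTop ν).eventually_const_lt h1).exists.imp fun _ h ↦ h.le)
  apply le_antisymm
  · refine ge_of_tendsto (x := 𝓝[>] a)
      (ENNReal.continuous_ofReal.continuousWithinAt (s := Ioi a)) ?_
    filter_upwards [Ioo_mem_nhdsGT ha1] with b hb
    obtain ⟨x, hx⟩ := key b (ha.trans_lt hb.1) hb.2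
    rw [← hx, ofReal_cdf]
    refine measure_mono fun y hy ↦ ?_
    by_contra hxy
    have := monotone_cdf ν (not_le.1 hxy).le
    have : cdf ν y ≤ a := hy
    linarith [hb.1]
  · rcases ha.eq_or_lt with rfl | ha
    · simp
    obtain ⟨x, hx⟩ := key a ha ha1
    rw [← hx, ofReal_cdf]
    exact measure_mono fun y hy ↦ monotone_cdf ν hy

open ProbabilityTheory Topology in
theorem exists_measurable_ae_leftInverse_cdf (ν : Measure ℝ) [IsProbabilityMeasure ν]
    (hc : Continuous (cdf ν)) :
    ∃ G : ℝ → ℝ, Measurable G ∧ ∀ᵐ x ∂ν, G (cdf ν x) = x := by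
  let H : ℝ → EReal := fun u ↦ ⨅ q : ℚ, if u ≤ cdf ν q then ((q : ℝ) : EReal) else ⊤
  have hH : Measurable H := by
    refine Measurable.iInf fun q ↦ Measurable.ite measurableSet_Iic measurable_const
      measurable_const
  refine ⟨fun u ↦ (H u).toReal, measurable_ereal_toReal.comp hH, ?_⟩
  have hq : ∀ᵐ x ∂ν, ∀ q : ℚ, cdf ν x ≠ cdf ν q := by
    refine ae_all_iff.2 fun q ↦ ?_
    have : ∀ᵐ y ∂(ν.map (cdf ν)), y ≠ cdf ν q := by
      rw [map_cdf_eq_unif01 ν hc]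
      exact ae_restrict_of_ae (Measure.ae_ne volume _)
    exact ae_of_ae_map hc.measurable.aemeasurable this
  filter_upwards [hq] with x hx
  have : H (cdf ν x) = (x : EReal) := by
    apply le_antisymm
    · refine le_of_forall_gt fun c hc ↦ ?_
      obtain ⟨q, hxq, hqc⟩ := EReal.lt_iff_exists_rat_btwn.1 hc
      refine (iInf_le _ q).trans_lt ?_
      rw [if_pos (monotone_cdf ν (by exact_mod_cast hxq.le))]
      exact hqc
    · refine le_iInf fun q ↦ ?_
      split_ifs with h
      · by_contra hqx
        have hqx : (q : ℝ) < x := by exact_mod_cast not_le.1 hqx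
        exact hx q (le_antisymm h (monotone_cdf ν hqx.le))
      · exact le_top
  simp [this]

theorem lintegral_fin_prod_eq_prod {n : ℕ} {E : Fin n → Type*} {mE : ∀ i, MeasurableSpace (E i)}
    (μ : ∀ i, Measure (E i)) [∀ i, SigmaFinite (μ i)]
    {f : ∀ i, E i → ENNReal} (hf : ∀ i, Measurable (f i)) :
    ∫⁻ x, ∏ i, f i (x i) ∂(Measure.pi μ) = ∏ i, ∫⁻ x, f i x ∂(μ i) := by
  induction n with
  | zero => simp
  | succ n ih =>
    have hm (i : Fin n) : Measurable (f i.succ) := hf i.succ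
    calc
      _ = ∫⁻ x : E 0 × ((i : Fin n) → E i.succ), f 0 x.1 * ∏ i : Fin n, f i.succ (x.2 i)
            ∂((μ 0).prod (Measure.pi fun i ↦ μ i.succ)) := by
        refine (lintegral_congr fun x ↦ Fin.prod_univ_succ _).trans ?_
        refine (measurePreserving_piFinSuccAbove μ 0).lintegral_comp
          (f := fun x ↦ f 0 x.1 * ∏ i : Fin n, f i.succ (x.2 i)) ?_
        exact ((hf 0).comp measurable_fst).mul (Finset.measurable_prod _ fun i _ ↦
          (hm i).comp ((measurable_pi_apply i).comp measurable_snd))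
      _ = (∫⁻ x, f 0 x ∂μ 0) * ∏ i : Fin n, ∫⁻ x, f i.succ x ∂(μ i.succ) := by
        rw [← ih (fun i ↦ μ i.succ) hm, ← lintegral_prod_mul (hf 0).aemeasurable]
        exact (Finset.measurable_prod _ fun i _ ↦
          (hm i).comp (measurable_pi_apply i)).aemeasurable
      _ = ∏ i, ∫⁻ x, f i x ∂(μ i) := by rw [Fin.prod_univ_succ]

theorem pi_withDensity {n : ℕ} {E : Fin n → Type*} {mE : ∀ i, MeasurableSpace (E i)}
    (μ : ∀ i, Measure (E i)) [∀ i, SigmaFinite (μ i)]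
    {f : ∀ i, E i → ENNReal} (hf : ∀ i, Measurable (f i))
    [∀ i, SigmaFinite ((μ i).withDensity (f i))] :
    Measure.pi (fun i ↦ (μ i).withDensity (f i)) =
      (Measure.pi μ).withDensity fun x ↦ ∏ i, f i (x i) := by
  refine Measure.pi_eq fun s hs ↦ ?_
  rw [withDensity_apply _ (MeasurableSet.univ_pi hs), Measure.restrict_pi_pi,
    lintegral_fin_prod_eq_prod _ hf]
  simp_rw [withDensity_apply _ (hs _)]

theorem map_withDensity_comp {α β : Type*} [MeasurableSpace α] [MeasurableSpace β]
    (μ : Measure α) {T : α → β} (hT : Measurable T) {g : β → ENNReal} (hg : Measurable g) :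
    (μ.withDensity (g ∘ T)).map T = (μ.map T).withDensity g := by
  ext s hs
  rw [Measure.map_apply hT hs, withDensity_apply _ (hT hs), withDensity_apply _ hs,
    setLIntegral_map hs hg hT]
  rfl

/-- **Sklar's theorem** (density form): a joint pdf with continuous marginal cdfs factors,
Lebesgue-a.e., as a copula density evaluated at the marginal cdfs times the product of the
marginal pdfs; the copula density is unique up to a Lebesgue-null subset of the cube. -/
theorem sklar_density {d : ℕ} (μ : Measure (Fin d → ℝ)) [IsProbabilityMeasure μ]
    (f : (Fin d → ℝ) → ℝ) (hfmeas : Measurable f) (hf0 : ∀ z, 0 ≤ f z)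
    (hμ : μ = volume.withDensity (fun z => ENNReal.ofReal (f z)))
    (fm : Fin d → ℝ → ℝ) (hfmmeas : ∀ i, Measurable (fm i)) (hfm0 : ∀ i x, 0 ≤ fm i x)
    (hmarg : ∀ i, μ.map (fun z => z i) = volume.withDensity (fun x => ENNReal.ofReal (fm i x)))
    (F : Fin d → ℝ → ℝ)
    (hF : ∀ i x, F i x = (μ.map (fun z => z i) (Set.Iic x)).toReal)
    (hFcont : ∀ i, Continuous (F i)) :
    (∃ c : (Fin d → ℝ) → ℝ, Measurable c ∧ (∀ u, 0 ≤ c u) ∧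
      IsCopula ((volume.restrict (Cube d)).withDensity (fun u => ENNReal.ofReal (c u))) ∧
      (∀ᵐ z ∂(volume : Measure (Fin d → ℝ)),
        f z = c (fun i => F i (z i)) * ∏ i, fm i (z i))) ∧
    (∀ c c' : (Fin d → ℝ) → ℝ,
      (Measurable c ∧ (∀ u, 0 ≤ c u) ∧
        IsCopula ((volume.restrict (Cube d)).withDensity (fun u => ENNReal.ofReal (c u))) ∧
        (∀ᵐ z ∂(volume : Measure (Fin d → ℝ)),
          f z = c (fun i => F i (z i)) * ∏ i, fm i (z i))) →
      (Measurable c' ∧ (∀ u, 0 ≤ c' u) ∧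
        IsCopula ((volume.restrict (Cube d)).withDensity (fun u => ENNReal.ofReal (c' u))) ∧
        (∀ᵐ z ∂(volume : Measure (Fin d → ℝ)),
          f z = c' (fun i => F i (z i)) * ∏ i, fm i (z i))) →
      c =ᵐ[volume.restrict (Cube d)] c') := by
  have hprob (i : Fin d) : IsProbabilityMeasure (μ.map fun z ↦ z i) :=
    Measure.isProbabilityMeasure_map (measurable_pi_apply i).aemeasurable
  have hFcdf (i : Fin d) : F i = ProbabilityTheory.cdf (μ.map fun z ↦ z i) := by
    ext x
    rw [hF, ProbabilityTheory.cdf_eq_real, measureReal_def]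
  have hPIT (i : Fin d) : (μ.map fun z ↦ z i).map (F i) = unif01 := by
    have := map_cdf_eq_unif01 (μ.map fun z ↦ z i) (hFcdf i ▸ hFcont i)
    rwa [← hFcdf] at this
  have hleft (i : Fin d) :
      ∃ G : ℝ → ℝ, Measurable G ∧ ∀ᵐ x ∂(μ.map fun z ↦ z i), G (F i x) = x := by
    rw [hFcdf]
    exact exists_measurable_ae_leftInverse_cdf _ (hFcdf i ▸ hFcont i)
  choose G hGmeas hG using hleft
  let T : (Fin d → ℝ) → Fin d → ℝ := fun z i ↦ F i (z i)
  have hT : Measurable T :=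
    measurable_pi_lambda _ fun i ↦ (hFcont i).measurable.comp (measurable_pi_apply i)
  let ρ : Measure (Fin d → ℝ) := Measure.pi fun i ↦ μ.map fun z ↦ z i
  let p : (Fin d → ℝ) → ℝ := fun z ↦ ∏ i, fm i (z i)
  have hpmeas : Measurable p :=
    Finset.measurable_prod _ fun i _ ↦ (hfmmeas i).comp (measurable_pi_apply i)
  have hp0 (z : Fin d → ℝ) : 0 ≤ p z := Finset.prod_nonneg fun i _ ↦ hfm0 i _
  have hρ : ρ = volume.withDensity fun z ↦ ENNReal.ofReal (p z) := by
    have (i : Fin d) :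
        SigmaFinite ((volume : Measure ℝ).withDensity fun x ↦ ENNReal.ofReal (fm i x)) := by
      rw [← hmarg]; infer_instance
    simp only [ρ, p, hmarg, ENNReal.ofReal_prod_of_nonneg fun i _ ↦ hfm0 i _]
    exact pi_withDensity _ fun i ↦ (hfmmeas i).ennreal_ofReal
  have hρT : ρ.map T = volume.restrict (Cube d) := by
    have (i : Fin d) : SigmaFinite ((μ.map fun z ↦ z i).map (F i)) := by
      rw [hPIT]; unfold unif01; infer_instance
    have h := Measure.pi_map_pi (μ := fun i ↦ μ.map fun z ↦ z i) (f := F)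
      fun i ↦ (hFcont i).measurable.aemeasurable
    refine h.trans ?_
    simp only [hPIT]
    rw [Cube, volume_pi, Measure.restrict_pi_pi]
    rfl
  have hρae {q : (Fin d → ℝ) → Prop} : (∀ᵐ z ∂ρ, q z) ↔ ∀ᵐ z, p z ≠ 0 → q z := by
    rw [hρ, ae_withDensity_iff hpmeas.ennreal_ofReal]
    simp only [ne_eq, ENNReal.ofReal_eq_zero, (hp0 _).ge_iff_eq']
  have hsupp : ∀ᵐ z, p z = 0 → f z = 0 := by
    have hpos : ∀ᵐ z ∂μ, ∀ i, fm i (z i) ≠ 0 := by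
      refine ae_all_iff.2 fun i ↦ ?_
      have : ∀ᵐ x ∂(μ.map fun z ↦ z i), fm i x ≠ 0 := by
        rw [hmarg, ae_withDensity_iff (hfmmeas i).ennreal_ofReal]
        refine ae_of_all _ fun x hx h ↦ hx (by simp [h])
      exact ae_of_ae_map (measurable_pi_apply i).aemeasurable this
    rw [hμ, ae_withDensity_iff hfmeas.ennreal_ofReal] at hpos
    filter_upwards [hpos] with z hz hpz
    by_contra hfz
    refine Finset.prod_ne_zero_iff.2 (fun i _ ↦ hz ?_ i) hpz
    simpa using lt_of_le_of_ne (hf0 z) (Ne.symm hfz)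
  constructor
  · let S : (Fin d → ℝ) → Fin d → ℝ := fun u i ↦ G i (u i)
    have hS : Measurable S :=
      measurable_pi_lambda _ fun i ↦ (hGmeas i).comp (measurable_pi_apply i)
    have hST : ∀ᵐ z ∂ρ, S (T z) = z := by
      have : ∀ᵐ z ∂ρ, ∀ i, G i (F i (z i)) = z i :=
        ae_all_iff.2 fun i ↦
          (measurePreserving_eval (fun i ↦ μ.map fun z ↦ z i) i).quasiMeasurePreserving.ae (hG i)
      filter_upwards [this] with z hz using funext hz
    let c : (Fin d → ℝ) → ℝ := fun u ↦ f (S u) / p (S u)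
    have hcmeas : Measurable c := (hfmeas.comp hS).div (hpmeas.comp hS)
    have hfac : ∀ᵐ z, f z = c (T z) * p z := by
      filter_upwards [hsupp, hρae.1 hST] with z h0 h1
      by_cases hz : p z = 0
      · simp [hz, h0 hz]
      · simp only [c, h1 hz]
        field_simp
    have hmap : μ.map T = (volume.restrict (Cube d)).withDensity fun u ↦ ENNReal.ofReal (c u) := by
      rw [← hρT, ← map_withDensity_comp ρ hT hcmeas.ennreal_ofReal, hρ,
        ← withDensity_mul _ hpmeas.ennreal_ofReal (hcmeas.ennreal_ofReal.comp hT), hμ]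
      congr 1
      refine withDensity_congr_ae ?_
      filter_upwards [hfac] with z hz
      rw [hz, mul_comm, ENNReal.ofReal_mul (hp0 z)]
      rfl
    refine ⟨c, hcmeas, fun u ↦ div_nonneg (hf0 _) (hp0 _), ?_, hfac⟩
    rw [← hmap]
    have hac : μ.map T ≪ volume.restrict (Cube d) := hmap ▸ withDensity_absolutelyContinuous _ _
    have hP : IsProbabilityMeasure (μ.map T) := Measure.isProbabilityMeasure_map hT.aemeasurable
    refine ⟨hP, hac.trans Measure.absolutelyContinuous_restrict, ?_, fun i ↦ ?_⟩
    · have hcube : MeasurableSet (Cube d) := MeasurableSet.univ_pi fun _ ↦ measurableSet_Icc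
      exact (prob_compl_eq_zero_iff hcube).1 (hac (by simp [Measure.restrict_apply hcube.compl]))
    · rw [Measure.map_map (measurable_pi_apply i) hT, ← hPIT i,
        Measure.map_map (hFcont i).measurable (measurable_pi_apply i)]
      rfl
  · rintro c c' ⟨hc, -, -, h⟩ ⟨hc', -, -, h'⟩
    rw [← hρT]
    refine (ae_map_iff hT.aemeasurable (measurableSet_eq_fun hc hc')).2 (hρae.2 ?_)
    filter_upwards [h, h'] with z hz hz' hpz
    exact mul_right_cancel₀ hpz (hz.symm.trans hz')
end
end

section
/- Let z = (z_1, …, z_d) be a random vector in ℝ^d with a joint pdf and continuous marginal cdfs, and let g_1, …, g_d : ℝ → ℝ be continuous injective functions such that g(z) := (g_1(z_1), …, g_d(z_d)) also has a joint pdf with continuous marginal cdfs. If u_z and u_{g(z)} denote the copula-uniform dual representations of z and g(z) respectively, then h(u_z) = h(u_{g(z)}). -/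
open MeasureTheory Real Set Filter

noncomputable section
open scoped Classical

/-- Differential entropy is invariant under volume-preserving measurable equivalences. -/
lemma diffEnt_map_measurableEquiv {α β : Type*} [MeasureSpace α] [MeasureSpace β]
    [SigmaFinite (volume : Measure α)] (P : Measure α) [SigmaFinite P]
    (T : α ≃ᵐ β) (hT : MeasurePreserving T) : diffEnt (P.map T) = diffEnt P := by
  unfold diffEnt
  rw [← hT.integral_comp T.measurableEmbedding]
  congr 1
  apply integral_congr_ae
  have h := T.measurableEmbedding.rnDeriv_map P volume
  rw [hT.map_eq] at h
  filter_upwards [h] with x hx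
  simp only [dens, hx]

/-- The cdf of an atomless law is transported by an injective continuous map to itself
or to its survival function. -/
lemma cdf_comp_injective (ν : Measure ℝ) [IsProbabilityMeasure ν] [NullSingletonClass ν]
    {g : ℝ → ℝ} (hgc : Continuous g) (hgi : Function.Injective g) :
    (∀ t, (ν.map g).real (Iic (g t)) = ν.real (Iic t)) ∨
      ∀ t, (ν.map g).real (Iic (g t)) = 1 - ν.real (Iic t) := by
  have key (t : ℝ) : (ν.map g).real (Iic (g t)) = ν.real (g ⁻¹' Iic (g t)) :=
    map_measureReal_apply hgc.measurable measurableSet_Iic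
  rcases hgc.strictMono_of_inj hgi with hg | hg
  · left
    intro t
    rw [key]
    congr 1
    ext s
    simp [hg.le_iff_le]
  · right
    intro t
    have hpre : g ⁻¹' Iic (g t) = Ici t := by
      ext s
      simp [hg.le_iff_ge]
    rw [key, hpre, ← measureReal_congr (Ioi_ae_eq_Ici (μ := ν) (a := t)), ← compl_Iic,
      probReal_compl_eq_one_sub measurableSet_Iic]

/-- A coordinate marginal of an absolutely continuous law has no atoms. -/
lemma nullSingletonClass_map_eval {d : ℕ} {P : Measure (Fin d → ℝ)} (hP : P ≪ volume)
    (i : Fin d) :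
    NullSingletonClass (P.map fun v => v i) where
  measure_singleton t :=
    (hP.map (measurable_pi_apply i)).trans
      (Measure.quasiMeasurePreserving_eval (fun _ : Fin d => (volume : Measure ℝ))
        i).absolutelyContinuous
      (measure_singleton t)

/-- The copula entropy is invariant under coordinatewise continuous injective
transformations of the primal variables. -/
theorem copula_entropy_invariant {d : ℕ} {Ω : Type*} [MeasurableSpace Ω]
    (μ : Measure Ω) [IsProbabilityMeasure μ]
    (z : Ω → Fin d → ℝ) (hz : Measurable z)
    (hzpdf : μ.map z ≪ volume)
    (F : Fin d → ℝ → ℝ)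
    (hF : ∀ i t, F i t = ((μ.map z).map (fun v => v i) (Set.Iic t)).toReal)
    (hFc : ∀ i, Continuous (F i))
    (g : Fin d → ℝ → ℝ) (hgc : ∀ i, Continuous (g i)) (hgi : ∀ i, Function.Injective (g i))
    (hgzpdf : μ.map (fun ω i => g i (z ω i)) ≪ volume)
    (G : Fin d → ℝ → ℝ)
    (hG : ∀ i t, G i t = ((μ.map (fun ω i => g i (z ω i))).map (fun v => v i) (Set.Iic t)).toReal)
    (hGc : ∀ i, Continuous (G i)) :
    diffEnt (μ.map (fun ω i => F i (z ω i))) = diffEnt (μ.map (fun ω i => G i (g i (z ω i)))) := by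
  have hgz : Measurable (fun ω i => g i (z ω i)) :=
    measurable_pi_lambda _ fun i => (hgc i).measurable.comp ((measurable_pi_apply i).comp hz)
  have hFz : Measurable (fun ω i => F i (z ω i)) :=
    measurable_pi_lambda _ fun i => (hFc i).measurable.comp ((measurable_pi_apply i).comp hz)
  have hPz : IsProbabilityMeasure (μ.map z) := Measure.isProbabilityMeasure_map hz.aemeasurable
  have hPF : IsProbabilityMeasure (μ.map (fun ω i => F i (z ω i))) :=
    Measure.isProbabilityMeasure_map hFz.aemeasurable
  have hcoord (i : Fin d) : ∃ e : ℝ ≃ᵐ ℝ, MeasurePreserving e ∧ ∀ t, G i (g i t) = e (F i t) := by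
    have hν : IsProbabilityMeasure ((μ.map z).map fun v => v i) :=
      Measure.isProbabilityMeasure_map (measurable_pi_apply i).aemeasurable
    have hna := nullSingletonClass_map_eval hzpdf i
    have hmap : (μ.map (fun ω i => g i (z ω i))).map (fun v => v i) =
        ((μ.map z).map fun v => v i).map (g i) := by
      rw [Measure.map_map (measurable_pi_apply i) hgz, Measure.map_map (measurable_pi_apply i) hz,
        Measure.map_map (hgc i).measurable ((measurable_pi_apply i).comp hz)]
      rfl
    have hGg (t : ℝ) :
        G i (g i t) = (((μ.map z).map fun v => v i).map (g i)).real (Iic (g i t)) := by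
      rw [hG, hmap, measureReal_def]
    have hFr (t : ℝ) : F i t = ((μ.map z).map fun v => v i).real (Iic t) := hF i t
    rcases cdf_comp_injective ((μ.map z).map fun v => v i) (hgc i) (hgi i) with h | h
    · exact ⟨MeasurableEquiv.refl ℝ, MeasurePreserving.id _, fun t => by
        rw [hGg, h, ← hFr]; rfl⟩
    · exact ⟨MeasurableEquiv.subLeft 1, volume.measurePreserving_sub_left 1, fun t => by
        rw [hGg, h, ← hFr]; rfl⟩
  choose e he hGe using hcoord
  have hT : MeasurePreserving (MeasurableEquiv.piCongrRight e) := volume_preserving_pi he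
  rw [← diffEnt_map_measurableEquiv _ (MeasurableEquiv.piCongrRight e) hT,
    Measure.map_map (MeasurableEquiv.piCongrRight e).measurable hFz]
  congr 2
  funext ω i
  exact (hGe i (z ω i)).symm
end
end

section
/- If 𝒞(φ, α) contains some copula distribution with finite differential entropy, then there exists exactly one P_M ∈ 𝒞(φ, α) such that h(P_M) ≥ h(P) for every P ∈ 𝒞(φ, α) (i.e., the maximum-entropy problem over copula distributions subject to E_P[φ] = α admits a unique solution). -/
open MeasureTheory Real Set Filter

noncomputable section
open scoped Classical

/-- The set of copula distributions satisfying the linear constraint `E_P[φ] = α`. -/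
def InC {d q : ℕ} (φ : (Fin d → ℝ) → Fin q → ℝ) (α : Fin q → ℝ)
    (P : Measure (Fin d → ℝ)) : Prop :=
  IsCopula P ∧ ∀ j, ∫ u, φ u j ∂P = α j

section Auxiliary

open InformationTheory Topology

/-- Square-root refinement of the gap between `x log x` and its tangent line at `m`. -/
lemma sub_add_sq_sqrt_sub_le_mul_log_sub {a m : ℝ} (ha : 0 ≤ a) (hm : 0 < m) :
    (a - m) + (√a - √m) ^ 2 ≤ a * log a - a * log m := by
  have hsa := Real.sq_sqrt ha
  have hsm := Real.sq_sqrt hm.le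
  rcases ha.eq_or_lt with rfl | ha
  · simp [hsm]
  have hpa := Real.sqrt_pos.2 ha
  have hpm := Real.sqrt_pos.2 hm
  have hlog : log (√m / √a) ≤ √m / √a - 1 := Real.log_le_sub_one_of_pos (by positivity)
  rw [Real.log_div hpm.ne' hpa.ne', Real.log_sqrt hm.le, Real.log_sqrt ha.le] at hlog
  have hmul := mul_le_mul_of_nonneg_left hlog ha.le
  have hsimp : a * (√m / √a - 1) = √m * √a - a := by
    have : a / √a = √a := Real.div_sqrt
    calc a * (√m / √a - 1) = √m * (a / √a) - a := by ring
      _ = _ := by rw [this]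
  nlinarith

lemma abs_sub_le_sq_sqrt_sub_add {a m ε : ℝ} (ha : 0 ≤ a) (hm : 0 ≤ m) (hε : 0 < ε) :
    |a - m| ≤ (√a - √m) ^ 2 / (2 * ε) + ε * (a + m) := by
  have hsa := Real.sq_sqrt ha
  have hsm := Real.sq_sqrt hm
  have hfac : |a - m| = |√a - √m| * (√a + √m) := by
    rw [← abs_of_nonneg (by positivity : 0 ≤ √a + √m), ← abs_mul]
    congr 1
    nlinarith
  have hd : (√a - √m) ^ 2 / (2 * ε) = |√a - √m| ^ 2 / (2 * ε) := by rw [sq_abs]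
  rw [hfac, hd, ← sub_le_iff_le_add, le_div_iff₀ (by positivity)]
  nlinarith [sq_nonneg (|√a - √m| - ε * (√a + √m)),
    mul_nonneg (sq_nonneg ε) (sq_nonneg (√a - √m))]

/-- Quantitative strict convexity of `klFun` at midpoints. -/
lemma abs_sub_le_klFun_gap {a b ε : ℝ} (ha : 0 ≤ a) (hb : 0 ≤ b) (hε : 0 < ε) :
    |a - b| ≤ (klFun a + klFun b - 2 * klFun ((a + b) / 2)) / (2 * ε) + 2 * ε * (a + b) := by
  rcases (add_nonneg ha hb).eq_or_lt with h | h
  · obtain rfl : a = 0 := by linarith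
    obtain rfl : b = 0 := by linarith
    simp [two_mul]
  set m := (a + b) / 2 with hm
  have hm0 : 0 < m := by positivity
  have h1 := sub_add_sq_sqrt_sub_le_mul_log_sub ha hm0
  have h2 := sub_add_sq_sqrt_sub_le_mul_log_sub hb hm0
  have h3 := abs_sub_le_sq_sqrt_sub_add ha hm0.le hε
  have h4 := abs_sub_le_sq_sqrt_sub_add hb hm0.le hε
  have hgap : (√a - √m) ^ 2 + (√b - √m) ^ 2 ≤ klFun a + klFun b - 2 * klFun m := by
    simp only [klFun_apply]
    have : a + b = 2 * m := by rw [hm]; ring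
    have hmul : a * log m + b * log m = 2 * (m * log m) := by rw [← add_mul, this]; ring
    linarith
  have hdiv := div_le_div_of_nonneg_right hgap (by positivity : 0 ≤ 2 * ε)
  rw [add_div] at hdiv
  have htri : |a - b| ≤ |a - m| + |b - m| := by
    rw [abs_sub_comm b m]; exact abs_sub_le a m b
  have : ε * (a + m) + ε * (b + m) = 2 * ε * (a + b) := by rw [hm]; ring
  linarith

/-- Probability densities with prescribed moments. -/
structure IsMomentDensity {Ω ι : Type*} [MeasurableSpace Ω] (μ : Measure Ω)
    (g : ι → Ω → ℝ) (c : ι → ℝ) (p : Ω → ℝ) : Prop where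
  integrable : Integrable p μ
  nonneg : 0 ≤ᵐ[μ] p
  mass : ∫ x, p x ∂μ = 1
  moment : ∀ k, ∫ x, g k x * p x ∂μ = c k

section MomentDensity

variable {Ω ι : Type*} [MeasurableSpace Ω] {μ : Measure Ω} {g : ι → Ω → ℝ} {c : ι → ℝ}

lemma IsMomentDensity.congr {p q : Ω → ℝ} (hp : IsMomentDensity μ g c p) (h : p =ᵐ[μ] q) :
    IsMomentDensity μ g c q where
  integrable := hp.integrable.congr h
  nonneg := hp.nonneg.trans h.le
  mass := (integral_congr_ae h).symm.trans hp.mass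
  moment k := (integral_congr_ae (h.mono fun x hx => congrArg (g k x * ·) hx)).symm.trans
    (hp.moment k)

lemma IsMomentDensity.midpoint (hgm : ∀ k, AEStronglyMeasurable (g k) μ)
    (hgb : ∀ k, ∃ C, ∀ᵐ x ∂μ, ‖g k x‖ ≤ C) {p q : Ω → ℝ}
    (hp : IsMomentDensity μ g c p) (hq : IsMomentDensity μ g c q) :
    IsMomentDensity μ g c (fun x => (p x + q x) / 2) where
  integrable := (hp.integrable.add hq.integrable).div_const 2
  nonneg := by
    filter_upwards [hp.nonneg, hq.nonneg] with x h1 h2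
    simp only [Pi.zero_apply] at *
    positivity
  mass := by
    rw [integral_div, integral_add hp.integrable hq.integrable, hp.mass, hq.mass]
    norm_num
  moment k := by
    obtain ⟨C, hC⟩ := hgb k
    have h : ∀ x, g k x * ((p x + q x) / 2) = (g k x * p x + g k x * q x) / 2 := fun x => by ring
    simp only [h]
    rw [integral_div, integral_add (hp.integrable.bdd_mul (hgm k) hC)
      (hq.integrable.bdd_mul (hgm k) hC), hp.moment, hq.moment]
    ring

/-- If `I` bounds the `klFun`-integrals from below, densities nearly attaining `I` are `L¹`-close. -/
lemma IsMomentDensity.integral_abs_sub_le (hgm : ∀ k, AEStronglyMeasurable (g k) μ)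
    (hgb : ∀ k, ∃ C, ∀ᵐ x ∂μ, ‖g k x‖ ≤ C) {I : ℝ}
    (hI : ∀ r, IsMomentDensity μ g c r → Integrable (fun x => klFun (r x)) μ →
      I ≤ ∫ x, klFun (r x) ∂μ) {p q : Ω → ℝ}
    (hp : IsMomentDensity μ g c p) (hq : IsMomentDensity μ g c q)
    (hpi : Integrable (fun x => klFun (p x)) μ) (hqi : Integrable (fun x => klFun (q x)) μ)
    {ε : ℝ} (hε : 0 < ε) :
    ∫ x, |p x - q x| ∂μ ≤
      (∫ x, klFun (p x) ∂μ + ∫ x, klFun (q x) ∂μ - 2 * I) / (2 * ε) + 4 * ε := by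
  have hm := hp.midpoint hgm hgb hq
  have hmi : Integrable (fun x => klFun ((p x + q x) / 2)) μ := by
    refine (hpi.add hqi).mono'
      (continuous_klFun.comp_aestronglyMeasurable hm.integrable.aestronglyMeasurable) ?_
    filter_upwards [hp.nonneg, hq.nonneg] with x h1 h2
    simp only [Pi.zero_apply] at h1 h2
    have hc := convexOn_klFun.2 (Set.mem_Ici.2 h1) (Set.mem_Ici.2 h2)
      (by norm_num : (0 : ℝ) ≤ 1 / 2) (by norm_num : (0 : ℝ) ≤ 1 / 2) (by norm_num)
    simp only [smul_eq_mul] at hc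
    rw [Real.norm_of_nonneg (klFun_nonneg (by positivity))]
    rw [show (p x + q x) / 2 = 1 / 2 * p x + 1 / 2 * q x by ring]
    simp only [Pi.add_apply]
    linarith [klFun_nonneg h1, klFun_nonneg h2]
  have hadd : Integrable (fun x => klFun (p x) + klFun (q x)) μ := hpi.add hqi
  have hgap : Integrable (fun x => klFun (p x) + klFun (q x) - 2 * klFun ((p x + q x) / 2)) μ :=
    hadd.sub (hmi.const_mul 2)
  have hsum : Integrable (fun x => p x + q x) μ := hp.integrable.add hq.integrable
  calc ∫ x, |p x - q x| ∂μ
      ≤ ∫ x, ((klFun (p x) + klFun (q x) - 2 * klFun ((p x + q x) / 2)) / (2 * ε)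
          + 2 * ε * (p x + q x)) ∂μ := by
        refine integral_mono_ae (hp.integrable.sub hq.integrable).abs
          ((hgap.div_const _).add (hsum.const_mul _)) ?_
        filter_upwards [hp.nonneg, hq.nonneg] with x h1 h2
        exact abs_sub_le_klFun_gap h1 h2 hε
    _ = (∫ x, klFun (p x) ∂μ + ∫ x, klFun (q x) ∂μ
          - 2 * ∫ x, klFun ((p x + q x) / 2) ∂μ) / (2 * ε) + 4 * ε := by
        rw [integral_add (hgap.div_const _) (hsum.const_mul _), integral_div,
          integral_const_mul, integral_sub hadd (hmi.const_mul 2),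
          integral_add hpi hqi, integral_add hp.integrable hq.integrable, hp.mass, hq.mass,
          integral_const_mul]
        ring
    _ ≤ _ := by
        have := hI _ hm hmi
        gcongr

lemma integral_mul_eq_of_tendsto {p : ℕ → Ω → ℝ} {r f : Ω → ℝ} {C a : ℝ}
    (hp : ∀ n, Integrable (p n) μ) (hr : Integrable r μ)
    (hpr : Tendsto (fun n => ∫ x, |p n x - r x| ∂μ) atTop (𝓝 0))
    (hfm : AEStronglyMeasurable f μ) (hfb : ∀ᵐ x ∂μ, ‖f x‖ ≤ C)
    (ha : ∀ n, ∫ x, f x * p n x ∂μ = a) : ∫ x, f x * r x ∂μ = a := by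
  have hbound : ∀ n, |a - ∫ x, f x * r x ∂μ| ≤ C * ∫ x, |p n x - r x| ∂μ := fun n => by
    rw [← ha n, ← integral_sub ((hp n).bdd_mul hfm hfb) (hr.bdd_mul hfm hfb),
      ← integral_const_mul]
    refine norm_integral_le_of_norm_le (f := fun x => f x * p n x - f x * r x)
      (((hp n).sub hr).abs.const_mul C) ?_
    filter_upwards [hfb] with x hx
    rw [← mul_sub, norm_mul]
    exact mul_le_mul_of_nonneg_right hx (norm_nonneg _)
  have hlim := hpr.const_mul C
  rw [mul_zero] at hlim
  have := ge_of_tendsto' hlim hbound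
  exact (sub_eq_zero.1 (abs_eq_zero.1 (le_antisymm this (abs_nonneg _)))).symm

lemma ae_eq_of_integral_abs_sub_le {p q : Ω → ℝ} (hp : Integrable p μ) (hq : Integrable q μ)
    (h : ∀ ε > 0, ∫ x, |p x - q x| ∂μ ≤ ε) : p =ᵐ[μ] q := by
  have h0 : ∫ x, |p x - q x| ∂μ = 0 :=
    le_antisymm (le_of_forall_pos_le_add fun ε hε => by simpa using h ε hε)
      (integral_nonneg fun x => abs_nonneg _)
  have := (integral_eq_zero_iff_of_nonneg (fun x => abs_nonneg _) (hp.sub hq).abs).1 h0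
  filter_upwards [this] with x hx
  exact sub_eq_zero.1 (abs_eq_zero.1 hx)

lemma exists_integrable_tendsto_of_cauchy {p : ℕ → Ω → ℝ} (hp : ∀ n, Integrable (p n) μ)
    (hc : ∀ δ > 0, ∃ N, ∀ m ≥ N, ∀ n ≥ N, ∫ x, |p m x - p n x| ∂μ < δ) :
    ∃ r, Integrable r μ ∧ Tendsto (fun n => ∫ x, |p n x - r x| ∂μ) atTop (𝓝 0) := by
  have hcs : CauchySeq fun n => (hp n).toL1 := by
    refine Metric.cauchySeq_iff.2 fun δ hδ => ?_
    obtain ⟨N, hN⟩ := hc δ hδ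
    refine ⟨N, fun m hm n hn => ?_⟩
    rw [dist_eq_norm, ← Integrable.toL1_sub, L1.norm_of_fun_eq_integral_norm]
    exact hN m hm n hn
  obtain ⟨f, hf⟩ := cauchySeq_tendsto_of_complete hcs
  refine ⟨f, L1.integrable_coeFn f, ?_⟩
  have hd := tendsto_iff_dist_tendsto_zero.1 hf
  refine hd.congr fun n => ?_
  rw [dist_eq_norm, L1.norm_eq_integral_norm]
  refine integral_congr_ae ?_
  filter_upwards [Lp.coeFn_sub (hp n).toL1 f, (hp n).coeFn_toL1] with x h1 h2
  rw [h1, Pi.sub_apply, h2, Real.norm_eq_abs]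

lemma exists_subseq_tendsto_ae {p : ℕ → Ω → ℝ} {r : Ω → ℝ} (hp : ∀ n, Integrable (p n) μ)
    (hr : Integrable r μ) (h : Tendsto (fun n => ∫ x, |p n x - r x| ∂μ) atTop (𝓝 0)) :
    ∃ ns : ℕ → ℕ, StrictMono ns ∧
      ∀ᵐ x ∂μ, Tendsto (fun k => p (ns k) x) atTop (𝓝 (r x)) := by
  refine (tendstoInMeasure_of_tendsto_eLpNorm one_ne_zero
    (fun n => (hp n).aestronglyMeasurable) hr.aestronglyMeasurable ?_).exists_seq_tendsto_ae
  have h' := ENNReal.tendsto_ofReal h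
  rw [ENNReal.ofReal_zero] at h'
  refine h'.congr fun n => ?_
  rw [eLpNorm_one_eq_lintegral_enorm,
    ← ofReal_integral_norm_eq_lintegral_enorm ((hp n).sub hr)]
  rfl

lemma integrable_klFun_and_integral_le_of_tendsto {p : ℕ → Ω → ℝ} {r : Ω → ℝ} {I : ℝ}
    (hp0 : ∀ n, 0 ≤ᵐ[μ] p n) (hpi : ∀ n, Integrable (fun x => klFun (p n x)) μ)
    (hr : Integrable r μ) (hr0 : 0 ≤ᵐ[μ] r)
    (hI : Tendsto (fun n => ∫ x, klFun (p n x) ∂μ) atTop (𝓝 I))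
    (h : ∀ᵐ x ∂μ, Tendsto (fun n => p n x) atTop (𝓝 (r x))) :
    Integrable (fun x => klFun (r x)) μ ∧ ∫ x, klFun (r x) ∂μ ≤ I := by
  have hrm : AEStronglyMeasurable (fun x => klFun (r x)) μ :=
    continuous_klFun.comp_aestronglyMeasurable hr.aestronglyMeasurable
  have hk0 : 0 ≤ᵐ[μ] fun x => klFun (r x) := hr0.mono fun x hx => klFun_nonneg hx
  have hI0 : 0 ≤ I := ge_of_tendsto' hI fun n =>
    integral_nonneg_of_ae ((hp0 n).mono fun x hx => klFun_nonneg hx)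
  have hle : ∫⁻ x, ENNReal.ofReal (klFun (r x)) ∂μ ≤ ENNReal.ofReal I := by
    calc ∫⁻ x, ENNReal.ofReal (klFun (r x)) ∂μ
        = ∫⁻ x, liminf (fun n => ENNReal.ofReal (klFun (p n x))) atTop ∂μ := by
          refine lintegral_congr_ae ?_
          filter_upwards [h] with x hx
          exact (ENNReal.tendsto_ofReal
            ((continuous_klFun.tendsto _).comp hx)).liminf_eq.symm
      _ ≤ liminf (fun n => ∫⁻ x, ENNReal.ofReal (klFun (p n x)) ∂μ) atTop :=
          lintegral_liminf_le' fun n => (hpi n).aestronglyMeasurable.aemeasurable.ennreal_ofReal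
      _ = ENNReal.ofReal I := by
          refine Tendsto.liminf_eq ((ENNReal.tendsto_ofReal hI).congr fun n => ?_)
          exact ofReal_integral_eq_lintegral_ofReal (hpi n)
            ((hp0 n).mono fun x hx => klFun_nonneg hx)
  refine ⟨⟨hrm, ?_⟩, ?_⟩
  · rw [hasFiniteIntegral_iff_ofReal hk0]
    exact hle.trans_lt ENNReal.ofReal_lt_top
  · rw [integral_eq_lintegral_of_nonneg_ae hk0 hrm]
    exact ENNReal.toReal_le_of_le_ofReal hI0 hle

/-- The convex functional `∫ klFun p` has a minimiser on densities with prescribed bounded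
moments, unique almost everywhere. -/
theorem exists_minimizer_klFun (hgm : ∀ k, AEStronglyMeasurable (g k) μ)
    (hgb : ∀ k, ∃ C, ∀ᵐ x ∂μ, ‖g k x‖ ≤ C)
    (hne : ∃ p, IsMomentDensity μ g c p ∧ Integrable (fun x => klFun (p x)) μ) :
    ∃ r, (IsMomentDensity μ g c r ∧ Integrable (fun x => klFun (r x)) μ) ∧
      (∀ p, IsMomentDensity μ g c p → Integrable (fun x => klFun (p x)) μ →
        ∫ x, klFun (r x) ∂μ ≤ ∫ x, klFun (p x) ∂μ) ∧
      ∀ p, IsMomentDensity μ g c p → Integrable (fun x => klFun (p x)) μ →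
        ∫ x, klFun (p x) ∂μ ≤ ∫ x, klFun (r x) ∂μ → p =ᵐ[μ] r := by
  let S : Set ℝ := {J | ∃ p, IsMomentDensity μ g c p ∧ Integrable (fun x => klFun (p x)) μ ∧
    J = ∫ x, klFun (p x) ∂μ}
  have hSne : S.Nonempty := by
    obtain ⟨p, hp, hpi⟩ := hne
    exact ⟨_, p, hp, hpi, rfl⟩
  have hSb : BddBelow S := by
    refine ⟨0, ?_⟩
    rintro _ ⟨p, hp, -, rfl⟩
    exact integral_nonneg_of_ae (hp.nonneg.mono fun x hx => klFun_nonneg hx)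
  set I := sInf S
  have hI : ∀ p, IsMomentDensity μ g c p → Integrable (fun x => klFun (p x)) μ →
      I ≤ ∫ x, klFun (p x) ∂μ := fun p hp hpi => csInf_le hSb ⟨p, hp, hpi, rfl⟩
  obtain ⟨u, -, hu, huS⟩ := exists_seq_tendsto_sInf hSne hSb
  choose p hp hpi hup using huS
  have hpI : Tendsto (fun n => ∫ x, klFun (p n x) ∂μ) atTop (𝓝 I) :=
    hu.congr hup
  obtain ⟨r, hr, hpr⟩ := exists_integrable_tendsto_of_cauchy (fun n => (hp n).integrable)
    (μ := μ) (by
      intro δ hδ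
      set ε := δ / 8 with hε
      have hε0 : 0 < ε := by positivity
      obtain ⟨N, hN⟩ := eventually_atTop.1
        (hpI.eventually_lt_const (lt_add_of_pos_right I (by positivity : 0 < ε ^ 2)))
      refine ⟨N, fun m hm n hn => ?_⟩
      refine ((hp m).integral_abs_sub_le hgm hgb hI (hp n) (hpi m) (hpi n) hε0).trans_lt ?_
      have h1 := hN m hm
      have h2 := hN n hn
      have h3 : (∫ x, klFun (p m x) ∂μ + ∫ x, klFun (p n x) ∂μ - 2 * I) / (2 * ε) ≤ ε := by
        rw [div_le_iff₀ (by positivity)]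
        nlinarith
      linarith)
  obtain ⟨ns, hns, hae⟩ := exists_subseq_tendsto_ae (fun n => (hp n).integrable) hr hpr
  have hr0 : 0 ≤ᵐ[μ] r := by
    filter_upwards [hae, ae_all_iff.2 fun k => (hp (ns k)).nonneg] with x hx h0
    exact ge_of_tendsto' hx h0
  obtain ⟨hri, hrle⟩ := integrable_klFun_and_integral_le_of_tendsto
    (fun k => (hp (ns k)).nonneg) (fun k => hpi (ns k)) hr hr0
    (hpI.comp hns.tendsto_atTop) hae
  have hrf : IsMomentDensity μ g c r := by
    refine ⟨hr, hr0, ?_, fun k => ?_⟩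
    · simpa using integral_mul_eq_of_tendsto (f := fun _ => 1) (C := 1) (a := 1)
        (fun n => (hp n).integrable) hr hpr aestronglyMeasurable_const (by simp)
        (fun n => by simpa using (hp n).mass)
    · obtain ⟨C, hC⟩ := hgb k
      exact integral_mul_eq_of_tendsto (fun n => (hp n).integrable) hr hpr (hgm k) hC
        fun n => (hp n).moment k
  refine ⟨r, ⟨hrf, hri⟩, fun q hq hqi => hrle.trans (hI q hq hqi), fun q hq hqi hqr => ?_⟩
  refine ae_eq_of_integral_abs_sub_le hq.integrable hr fun ε hε => ?_
  refine (hq.integral_abs_sub_le hgm hgb hI hrf hqi hri (by positivity : 0 < ε / 4)).trans ?_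
  have : (∫ x, klFun (q x) ∂μ + ∫ x, klFun (r x) ∂μ - 2 * I) / (2 * (ε / 4)) ≤ 0 :=
    div_nonpos_of_nonpos_of_nonneg (by linarith) (by positivity)
  linarith

end MomentDensity

section Copula

variable {d q : ℕ} {φ : (Fin d → ℝ) → Fin q → ℝ} {α : Fin q → ℝ} {P : Measure (Fin d → ℝ)}

lemma measurableSet_cube (d : ℕ) : MeasurableSet (Cube d) :=
  MeasurableSet.univ_pi fun _ => measurableSet_Icc

lemma isFiniteMeasure_restrict_cube (d : ℕ) :
    IsFiniteMeasure ((volume : Measure (Fin d → ℝ)).restrict (Cube d)) :=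
  isFiniteMeasure_restrict.2 (isCompact_univ_pi fun _ => isCompact_Icc).measure_lt_top.ne

/-- The test functions encoding the constraints of `InC`: indicators of cylinders for the
marginals, and the coordinates of `φ`. -/
def copulaTest (φ : (Fin d → ℝ) → Fin q → ℝ) :
    (Fin d × {s : Set ℝ // MeasurableSet s}) ⊕ Fin q → (Fin d → ℝ) → ℝ
  | .inl k => ((fun u : Fin d → ℝ => u k.1) ⁻¹' k.2.1).indicator 1
  | .inr j => fun u => φ u j

/-- The expectations that a member of `InC φ α` assigns to `copulaTest φ`. -/
def copulaMoment (d : ℕ) (α : Fin q → ℝ) :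
    (Fin d × {s : Set ℝ // MeasurableSet s}) ⊕ Fin q → ℝ
  | .inl k => unif01.real k.2.1
  | .inr j => α j

lemma aestronglyMeasurable_copulaTest (hφ : Continuous φ) (μ : Measure (Fin d → ℝ)) (k) :
    AEStronglyMeasurable (copulaTest φ k) μ := by
  rcases k with k | j
  · exact (stronglyMeasurable_one.indicator
      (k.2.2.preimage (measurable_pi_apply k.1))).aestronglyMeasurable
  · exact ((continuous_apply j).comp hφ).aestronglyMeasurable

lemma copulaTest_bounded (hφb : ∃ C, ∀ u ∈ Cube d, ∀ j, |φ u j| ≤ C) (k) :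
    ∃ C, ∀ᵐ u ∂(volume.restrict (Cube d)), ‖copulaTest φ k u‖ ≤ C := by
  rcases k with k | j
  · refine ⟨1, Eventually.of_forall fun u => ?_⟩
    refine (norm_indicator_le_norm_self _ _).trans ?_
    simp
  · obtain ⟨C, hC⟩ := hφb
    refine ⟨C, ?_⟩
    filter_upwards [ae_restrict_mem (measurableSet_cube d)] with u hu
    exact hC u hu j

lemma ae_dens_eq_zero_of_notMem [SigmaFinite P] {K : Set (Fin d → ℝ)} (hK : MeasurableSet K)
    (hP : P Kᶜ = 0) : ∀ᵐ u ∂(volume : Measure (Fin d → ℝ)), u ∉ K → dens P u = 0 := by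
  have hres : P.restrict K = P := Measure.restrict_eq_self_of_ae_mem hP
  have h := Measure.rnDeriv_restrict P volume hK
  rw [hres] at h
  filter_upwards [h] with u hu hn
  rw [dens, hu, indicator_of_notMem hn, ENNReal.toReal_zero]

lemma integral_eq_setIntegral_mul_dens [SigmaFinite P] (hac : P ≪ volume)
    (h0 : P (Cube d)ᶜ = 0) (f : (Fin d → ℝ) → ℝ) :
    ∫ u, f u ∂P = ∫ u in Cube d, f u * dens P u := by
  rw [← integral_rnDeriv_smul hac, setIntegral_eq_integral_of_ae_compl_eq_zero]
  · simp only [smul_eq_mul, dens, mul_comm]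
  · filter_upwards [ae_dens_eq_zero_of_notMem (measurableSet_cube d) h0] with u hu hn
    rw [hu hn, mul_zero]

lemma inC_iff_isMomentDensity [IsFiniteMeasure P] (hac : P ≪ volume)
    (h0 : P (Cube d)ᶜ = 0) :
    InC φ α P ↔ IsMomentDensity (volume.restrict (Cube d)) (copulaTest φ)
      (copulaMoment d α) (dens P) := by
  have hcyl : ∀ (i : Fin d) (s : Set ℝ), MeasurableSet s →
      ∫ u in Cube d, ((fun u : Fin d → ℝ => u i) ⁻¹' s).indicator 1 u * dens P u
        = (P.map fun u => u i).real s := fun i s hs => by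
    rw [← integral_eq_setIntegral_mul_dens hac h0,
      integral_indicator_one (hs.preimage (measurable_pi_apply i)),
      map_measureReal_apply (measurable_pi_apply i) hs]
  have hmass : ∫ u in Cube d, dens P u = P.real univ := by
    simpa using (integral_eq_setIntegral_mul_dens hac h0 fun _ => 1).symm
  constructor
  · rintro ⟨hC, hm⟩
    have := hC.prob
    refine ⟨Measure.integrable_toReal_rnDeriv.integrableOn,
      Eventually.of_forall fun u => ENNReal.toReal_nonneg, ?_, ?_⟩
    · rw [hmass, probReal_univ]
    · rintro (⟨i, s, hs⟩ | j)
      · exact (hcyl i s hs).trans (by rw [hC.marg i]; rfl)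
      · exact (integral_eq_setIntegral_mul_dens hac h0 _).symm.trans (hm j)
  · intro h
    have hprob : IsProbabilityMeasure P := by
      refine ⟨?_⟩
      have := hmass.symm.trans h.mass
      rwa [measureReal_def, ENNReal.toReal_eq_one_iff] at this
    refine ⟨⟨hprob, hac, (prob_compl_eq_zero_iff (measurableSet_cube d)).1 h0, fun i => ?_⟩,
      fun j => (integral_eq_setIntegral_mul_dens hac h0 _).trans (h.moment (.inr j))⟩
    ext s hs
    have hfin : IsFiniteMeasure unif01 := by
      rw [unif01]; infer_instance
    have := (hcyl i s hs).symm.trans (h.moment (.inl (i, ⟨s, hs⟩)))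
    exact (measureReal_eq_measureReal_iff).1 this

lemma finiteEnt_iff_integrable_klFun [IsProbabilityMeasure P] (h0 : P (Cube d)ᶜ = 0) :
    FiniteEnt P ↔ Integrable (fun u => klFun (dens P u)) (volume.restrict (Cube d)) := by
  have := isFiniteMeasure_restrict_cube d
  have hdi : Integrable (dens P) (volume.restrict (Cube d)) :=
    Measure.integrable_toReal_rnDeriv.integrableOn
  have hoff : ∀ᵐ u ∂(volume : Measure (Fin d → ℝ)), u ∉ Cube d →
      dens P u * log (dens P u) = 0 := by
    filter_upwards [ae_dens_eq_zero_of_notMem (measurableSet_cube d) h0] with u hu hn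
    rw [hu hn, zero_mul]
  constructor
  · intro h
    exact ((h.integrableOn (s := Cube d)).add (integrable_const 1)).sub hdi
  · intro h
    refine IntegrableOn.integrable_of_ae_notMem_eq_zero (s := Cube d) ?_ hoff
    have h' := (h.sub (integrable_const 1)).add hdi
    refine h'.congr (Eventually.of_forall fun u => ?_)
    simp only [Pi.add_apply, Pi.sub_apply, klFun_apply]
    ring

lemma diffEnt_eq_sub_integral_klFun [IsProbabilityMeasure P] (hac : P ≪ volume)
    (h0 : P (Cube d)ᶜ = 0) (hP : FiniteEnt P) :
    diffEnt P = (volume.restrict (Cube d)).real univ - 1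
      - ∫ u in Cube d, klFun (dens P u) := by
  have := isFiniteMeasure_restrict_cube d
  have hdi : Integrable (dens P) (volume.restrict (Cube d)) :=
    Measure.integrable_toReal_rnDeriv.integrableOn
  have hoff : ∀ᵐ u ∂(volume : Measure (Fin d → ℝ)), u ∉ Cube d →
      dens P u * log (dens P u) = 0 := by
    filter_upwards [ae_dens_eq_zero_of_notMem (measurableSet_cube d) h0] with u hu hn
    rw [hu hn, zero_mul]
  have hpi : Integrable (fun u => dens P u * log (dens P u)) (volume.restrict (Cube d)) :=
    hP.integrableOn
  have hadd : Integrable (fun u => dens P u * log (dens P u) + 1) (volume.restrict (Cube d)) :=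
    hpi.add (integrable_const 1)
  have hmass : ∫ u in Cube d, dens P u = 1 := by
    simpa using (integral_eq_setIntegral_mul_dens hac h0 fun _ => 1).symm
  simp only [klFun_apply]
  rw [diffEnt, ← setIntegral_eq_integral_of_ae_compl_eq_zero hoff, integral_sub hadd hdi,
    integral_add hpi (integrable_const 1), hmass, integral_const, smul_eq_mul, mul_one]
  ring

/-- Every integrable nonnegative function on the cube is the density of a finite measure. -/
lemma exists_measure_dens_eq {p : (Fin d → ℝ) → ℝ}
    (hp : Integrable p (volume.restrict (Cube d))) (hp0 : 0 ≤ᵐ[volume.restrict (Cube d)] p) :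
    ∃ P : Measure (Fin d → ℝ), IsFiniteMeasure P ∧ P ≪ volume ∧ P (Cube d)ᶜ = 0 ∧
      dens P =ᵐ[volume.restrict (Cube d)] p := by
  have hK := measurableSet_cube d
  have hpi : Integrable ((Cube d).indicator p) volume := (integrable_indicator_iff hK).2 hp
  refine ⟨volume.withDensity fun u => ENNReal.ofReal ((Cube d).indicator p u),
    isFiniteMeasure_withDensity_ofReal hpi.2, withDensity_absolutelyContinuous _ _, ?_, ?_⟩
  · rw [withDensity_apply _ hK.compl, setLIntegral_congr_fun (g := fun _ => 0) hK.compl]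
    · simp
    · intro u hu
      simp [indicator_of_notMem hu]
  · have h := Measure.rnDeriv_withDensity₀ volume
      hpi.aestronglyMeasurable.aemeasurable.ennreal_ofReal
    filter_upwards [ae_restrict_of_ae h, hp0, ae_restrict_mem hK] with u hu h0 hm
    rw [dens, hu, indicator_of_mem hm, ENNReal.toReal_ofReal h0]

lemma eq_of_dens_ae_eq {P Q : Measure (Fin d → ℝ)} [IsFiniteMeasure P] [IsFiniteMeasure Q]
    (hP : P ≪ volume) (hQ : Q ≪ volume) (hP0 : P (Cube d)ᶜ = 0) (hQ0 : Q (Cube d)ᶜ = 0)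
    (h : dens P =ᵐ[volume.restrict (Cube d)] dens Q) : P = Q := by
  have hK := measurableSet_cube d
  rw [← Measure.withDensity_rnDeriv_eq P volume hP, ← Measure.withDensity_rnDeriv_eq Q volume hQ]
  refine withDensity_congr_ae ?_
  filter_upwards [(ae_restrict_iff' hK).1 h, ae_dens_eq_zero_of_notMem hK hP0,
    ae_dens_eq_zero_of_notMem hK hQ0, P.rnDeriv_ne_top volume, Q.rnDeriv_ne_top volume]
    with u h1 h2 h3 h4 h5
  refine (ENNReal.toReal_eq_toReal_iff' h4 h5).1 ?_
  by_cases hu : u ∈ Cube d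
  · exact h1 hu
  · exact (h2 hu).trans (h3 hu).symm

end Copula

end Auxiliary

/-- If the constraint set of copula distributions is feasible with finite entropy, the
maximum-entropy problem (MIND) over copulas admits a unique solution. -/
theorem mind_exists_unique {d q : ℕ} [NeZero q]
    (φ : (Fin d → ℝ) → Fin q → ℝ) (hφc : Continuous φ)
    (hφb : ∃ C, ∀ u ∈ Cube d, ∀ j, |φ u j| ≤ C)
    (hφ1 : ∀ u, φ u 0 = 1)
    (hφli : ∀ θ : Fin q → ℝ,
      (∀ᵐ u ∂volume.restrict (Cube d), ∑ j, θ j * φ u j = 0) → θ = 0)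
    (α : Fin q → ℝ) (hα : α 0 = 1)
    (hfeas : ∃ P, InC φ α P ∧ FiniteEnt P) :
    ∃! PM : Measure (Fin d → ℝ), InC φ α PM ∧ FiniteEnt PM ∧
      ∀ P, InC φ α P → FiniteEnt P → diffEnt P ≤ diffEnt PM := by
  have hcompl : ∀ P, InC φ α P → P (Cube d)ᶜ = 0 := fun P hP => by
    have := hP.1.prob
    exact (prob_compl_eq_zero_iff (measurableSet_cube d)).2 hP.1.mass
  have hdens : ∀ P, InC φ α P → IsMomentDensity (volume.restrict (Cube d)) (copulaTest φ)
      (copulaMoment d α) (dens P) := fun P hP => by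
    have := hP.1.prob
    exact (inC_iff_isMomentDensity hP.1.ac (hcompl P hP)).1 hP
  have hent : ∀ P, InC φ α P → (FiniteEnt P ↔
      Integrable (fun u => InformationTheory.klFun (dens P u)) (volume.restrict (Cube d))) :=
    fun P hP => by
      have := hP.1.prob
      exact finiteEnt_iff_integrable_klFun (hcompl P hP)
  have hval : ∀ P, InC φ α P → FiniteEnt P →
      diffEnt P = (volume.restrict (Cube d)).real univ - 1
        - ∫ u in Cube d, InformationTheory.klFun (dens P u) := fun P hP hPf => by
    have := hP.1.prob
    exact diffEnt_eq_sub_integral_klFun hP.1.ac (hcompl P hP) hPf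
  obtain ⟨P₀, hP₀, hP₀f⟩ := hfeas
  obtain ⟨r, ⟨hr, hri⟩, hmin, huniq⟩ := exists_minimizer_klFun
    (aestronglyMeasurable_copulaTest hφc _) (copulaTest_bounded hφb)
    ⟨dens P₀, hdens P₀ hP₀, (hent P₀ hP₀).1 hP₀f⟩
  obtain ⟨PM, hfin, hac, h0, hPMr⟩ := exists_measure_dens_eq hr.integrable hr.nonneg
  have hkl : (fun u => InformationTheory.klFun (dens PM u)) =ᵐ[volume.restrict (Cube d)]
      fun u => InformationTheory.klFun (r u) := hPMr.mono fun u hu => congrArg _ hu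
  have hPM : InC φ α PM :=
    (inC_iff_isMomentDensity hac h0).2 (hr.congr hPMr.symm)
  have hPMf : FiniteEnt PM := (hent PM hPM).2 (hri.congr hkl.symm)
  refine ⟨PM, ⟨hPM, hPMf, fun P hP hPf => ?_⟩, fun Q hQ => ?_⟩
  · rw [hval P hP hPf, hval PM hPM hPMf, integral_congr_ae hkl]
    linarith [hmin _ (hdens P hP) ((hent P hP).1 hPf)]
  · obtain ⟨hQC, hQf, hQmax⟩ := hQ
    have hle := hQmax PM hPM hPMf
    rw [hval Q hQC hQf, hval PM hPM hPMf, integral_congr_ae hkl] at hle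
    have hQr := huniq _ (hdens Q hQC) ((hent Q hQC).1 hQf) (by linarith)
    have := hQC.1.prob
    exact eq_of_dens_ae_eq hQC.1.ac hac (hcompl Q hQC) h0 (hQr.trans hPMr.symm)
end
end
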